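/- Assume (H3) and 0 < μ̂ < ∞. If h(s_*) > (1/(1 − s_*)) ∫_{s_*}^1 h(t) dt, then there exists c_B ∈ [h(s_*), h_M + (p')^{1/p'} p^{1/p} μ̂^{1/p'}] such that, for every c ∈ ℝ, the boundary value problem on [s_*, 1] admits a (necessarily unique) positive solution if and only if c ≥ c_B. If instead h(s_*) ≤ (1/(1 − s_*)) ∫_{s_*}^1 h(t) dt, the same conclusion holds with c_B ∈ ((1/(1 − s_*)) ∫_{s_*}^1 h(t) dt, h_M + (p')^{1/p'} p^{1/p} μ̂^{1/p'}]. -/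

import Mathlib

open MeasureTheory Set Filter Topology intervalIntegral

noncomputable section

/-- A Carathéodory solution on `[a,b]` of the ODE
`y'(t) = p' * ((c - h t) * (y⁺ t)^(1/p) - f t)`, in integral form. -/
def IsCaraSol (p p' : ℝ) (h f : ℝ → ℝ) (c a b : ℝ) (y : ℝ → ℝ) : Prop :=
  ContinuousOn y (Set.Icc a b) ∧
  ∀ t ∈ Set.Icc a b,
    y t = y a + ∫ u in a..t, p' * ((c - h u) * (max (y u) 0) ^ (1 / p) - f u)

/-- A positive solution of the boundary value problem on `[a,b]`. -/
def IsPosBVPSol (p p' : ℝ) (h f : ℝ → ℝ) (c a b : ℝ) (y : ℝ → ℝ) : Prop :=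
  IsCaraSol p p' h f c a b y ∧ y a = 0 ∧ y b = 0 ∧ ∀ t ∈ Set.Ioo a b, 0 < y t

lemma abs_intervalIntegral_le {g : ℝ → ℝ} {a b C : ℝ} (h : ∀ x ∈ uIoc a b, |g x| ≤ C) :
    |∫ x in a..b, g x| ≤ C * |b - a| := by
  rw [← Real.norm_eq_abs (∫ x in a..b, g x)]
  exact intervalIntegral.norm_integral_le_of_norm_le_const fun x hx =>
    (Real.norm_eq_abs _).trans_le (h x hx)

/-- If `w a > 0` and `w` does not drop below `w a` as long as it stays positive, then `w b > 0`. -/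
lemma pos_of_continuation {w : ℝ → ℝ} {a b : ℝ} (hab : a ≤ b)
    (hw : ContinuousOn w (Icc a b)) (ha : 0 < w a)
    (H : ∀ t ∈ Ioo a b, (∀ u ∈ Icc a t, 0 < w u) → w a ≤ w t) : 0 < w b := by
  by_contra! hb
  have hcomp : IsCompact (Icc a b ∩ w ⁻¹' Iic 0) :=
    isCompact_Icc.of_isClosed_subset (hw.preimage_isClosed_of_isClosed isClosed_Icc isClosed_Iic)
      inter_subset_left
  obtain ⟨t, ⟨htab, htw⟩, hmin⟩ := hcomp.exists_isLeast ⟨b, right_mem_Icc.2 hab, hb⟩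
  have htw' : w t ≤ 0 := htw
  have hat : a < t := by
    rcases htab.1.eq_or_lt with h | h
    · rw [← h] at htw'; linarith
    · exact h
  have hpos : ∀ u ∈ Ico a t, 0 < w u := by
    intro u hu
    by_contra! hcon
    exact absurd (hmin ⟨⟨hu.1, hu.2.le.trans htab.2⟩, hcon⟩) (not_le.2 hu.2)
  have hle : ∀ u ∈ Ioo a t, w a ≤ w u := fun u hu =>
    H u ⟨hu.1, hu.2.trans_le htab.2⟩ fun v hv => hpos v ⟨hv.1, hv.2.trans_lt hu.2⟩
  have hlim : Tendsto w (𝓝[Ioo a t] t) (𝓝 (w t)) :=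
    (hw t htab).mono_left
      (nhdsWithin_mono t fun u hu => ⟨hu.1.le, hu.2.le.trans htab.2⟩)
  have : (𝓝[Ioo a t] t).NeBot := by
    rw [nhdsWithin_Ioo_eq_nhdsLT hat]; infer_instance
  have := ge_of_tendsto hlim (eventually_mem_nhdsWithin.mono hle)
  linarith

/-- Chain rule for powers of a Lipschitz function given as an integral. -/
lemma rpow_sub_rpow_eq_integral {y G : ℝ → ℝ} {a b L m N r : ℝ} (hab : a ≤ b) (hm : 0 < m)
    (hG : IntervalIntegrable G volume a b) (hGL : ∀ u ∈ Icc a b, |G u| ≤ L)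
    (hy : ∀ t ∈ Icc a b, y t = y a + ∫ u in a..t, G u)
    (hymN : ∀ t ∈ Icc a b, y t ∈ Icc m N) :
    y b ^ r - y a ^ r = ∫ u in a..b, r * y u ^ (r - 1) * G u := by
  have hGi : ∀ x ∈ Icc a b, IntervalIntegrable G volume a x := fun x hx =>
    hG.mono_set (by rw [uIcc_of_le hx.1, uIcc_of_le hab]; exact Icc_subset_Icc_right hx.2)
  have hL : 0 ≤ L := (abs_nonneg _).trans (hGL a (left_mem_Icc.2 hab))
  have hlipy : LipschitzOnWith (Real.toNNReal L) y (Icc a b) := by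
    apply LipschitzOnWith.of_dist_le_mul
    intro u hu v hv
    rw [Real.coe_toNNReal _ hL, Real.dist_eq, Real.dist_eq, hy u hu, hy v hv,
      add_sub_add_left_eq_sub, integral_interval_sub_left (hGi u hu) (hGi v hv)]
    refine abs_intervalIntegral_le fun x hx => hGL x ?_
    exact (ordConnected_Icc.uIcc_subset hv hu) (uIoc_subset_uIcc hx)
  obtain ⟨K, hK⟩ : ∃ K, LipschitzOnWith K (fun x : ℝ => x ^ r) (Icc m N) := by
    refine ContDiffOn.exists_lipschitzOnWith (n := 1) ?_ (by decide) (convex_Icc _ _) isCompact_Icc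
    intro x hx
    exact (Real.contDiffAt_rpow_const_of_ne (hm.trans_le hx.1).ne').contDiffWithinAt
  have hcomp : LipschitzOnWith (K * Real.toNNReal L) (fun t => y t ^ r) (uIcc a b) := by
    rw [uIcc_of_le hab]
    exact hK.comp hlipy fun t ht => hymN t ht
  rw [← hcomp.absolutelyContinuousOnInterval.integral_deriv_eq_sub]
  apply intervalIntegral.integral_congr_ae
  have hb : ∀ᵐ x : ℝ, x ≠ b := by simp [ae_iff, measure_singleton]
  filter_upwards [hG.ae_hasDerivAt_integral, hb] with x hx hxb hxab
  rw [uIoc_of_le hab] at hxab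
  have hxI : x ∈ Icc a b := ⟨hxab.1.le, hxab.2⟩
  have hd := hx (by rwa [uIcc_of_le hab]) a left_mem_uIcc
  have hev : y =ᶠ[𝓝 x] fun t => y a + ∫ u in a..t, G u := by
    filter_upwards [Icc_mem_nhds hxab.1 (lt_of_le_of_ne hxab.2 hxb)] with t ht using hy t ht
  have hyd : HasDerivAt y (G x) x := (hd.const_add (y a)).congr_of_eventuallyEq hev
  have := (hyd.rpow_const (p := r) (Or.inl (hm.trans_le (hymN x hxI).1).ne')).deriv
  rw [this]; ring

/-- Approximate terminal value problem with delayed argument. -/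
lemma exists_delayed_solution {G : ℝ → ℝ → ℝ} {a b : ℝ} {K : NNReal} (hab : a ≤ b)
    (hmeas : ∀ v : ℝ → ℝ, Continuous v →
      AEStronglyMeasurable (fun u => G u (v u)) (volume.restrict (Ioc a b)))
    (hbound : ∀ u ∈ Icc a b, ∀ v, |G u v| ≤ K) {δ : ℝ} (hδ : 0 < δ) :
    ∃ v : ℝ → ℝ, LipschitzWith K v ∧
      ∀ t ∈ Icc a b, v t = ∫ u in t..b, G u (v (u + δ)) := by
  let Φ : (ℝ → ℝ) → ℝ → ℝ := fun v t => ∫ u in (projIcc a b hab t : ℝ)..b, G u (v (u + δ))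
  have hint : ∀ v : ℝ → ℝ, Continuous v →
      IntervalIntegrable (fun u => G u (v (u + δ))) volume a b := by
    intro v hv
    rw [intervalIntegrable_iff_integrableOn_Ioc_of_le hab]
    refine Integrable.of_bound (hmeas (fun u => v (u + δ)) (by fun_prop)) K ?_
    filter_upwards [ae_restrict_mem measurableSet_Ioc] with u hu
    exact hbound u ⟨hu.1.le, hu.2⟩ _
  have hlip : ∀ v : ℝ → ℝ, Continuous v → LipschitzWith K (Φ v) := by
    intro v hv
    apply LipschitzWith.of_dist_le_mul
    intro x z
    have hi : ∀ w : ℝ, IntervalIntegrable (fun u => G u (v (u + δ))) volume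
        (projIcc a b hab w : ℝ) b := fun w => (hint v hv).mono_set (by
      rw [uIcc_of_le hab, uIcc_of_le (projIcc a b hab w).2.2]
      exact Icc_subset_Icc_left (projIcc a b hab w).2.1)
    have h1 : Φ v x - Φ v z = ∫ u in (projIcc a b hab x : ℝ)..(projIcc a b hab z : ℝ),
        G u (v (u + δ)) := by
      simp only [Φ]
      rw [sub_eq_iff_eq_add, integral_add_adjacent_intervals ?_ (hi z)]
      exact (hi x).trans (hi z).symm
    rw [Real.dist_eq, h1]
    calc |∫ u in (projIcc a b hab x : ℝ)..(projIcc a b hab z : ℝ), G u (v (u + δ))|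
        ≤ K * |(projIcc a b hab z : ℝ) - projIcc a b hab x| := by
          refine abs_intervalIntegral_le fun u hu => hbound u ?_ _
          exact (ordConnected_Icc.uIcc_subset (projIcc a b hab x).2 (projIcc a b hab z).2)
            (uIoc_subset_uIcc hu)
      _ ≤ K * dist x z := by
          gcongr
          rw [abs_sub_comm]
          exact abs_projIcc_sub_projIcc hab
  have hcont : ∀ k : ℕ, Continuous (Φ^[k] 0) ∧ LipschitzWith K (Φ^[k] 0) := by
    intro k
    induction k with
    | zero =>
      have : LipschitzWith K (0 : ℝ → ℝ) := (LipschitzWith.const (0 : ℝ)).weaken zero_le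
      exact ⟨this.continuous, this⟩
    | succ k ih =>
      rw [Function.iterate_succ_apply']
      exact ⟨(hlip _ ih.1).continuous, hlip _ ih.1⟩
  have hstab : ∀ k : ℕ, ∀ t, b - k * δ ≤ t → Φ^[k + 1] 0 t = Φ^[k] 0 t := by
    intro k
    induction k with
    | zero =>
      intro t ht
      have : b ≤ t := by simpa using ht
      simp [Φ, projIcc_of_right_le hab this]
    | succ k ih =>
      intro t ht
      rw [Function.iterate_succ_apply' Φ (k + 1)]
      nth_rw 2 [Function.iterate_succ_apply' Φ k]
      apply intervalIntegral.integral_congr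
      intro u hu
      rw [uIcc_of_le (projIcc a b hab t).2.2] at hu
      have hmin : min b t ≤ u := by
        refine le_trans ?_ hu.1
        rw [coe_projIcc]; exact le_max_right _ _
      show G u _ = G u _
      rw [ih (u + δ)]
      push_cast at ht
      rcases min_le_iff.1 hmin with h | h
      · have : 0 ≤ (k : ℝ) * δ := by positivity
        linarith
      · linarith
  obtain ⟨N, hN⟩ := exists_nat_ge ((b - a) / δ)
  refine ⟨Φ^[N] 0, (hcont N).2, fun t ht => ?_⟩
  rw [← hstab N t, Function.iterate_succ_apply']
  · simp only [Φ]
    rw [projIcc_of_mem hab ht]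
  · rw [div_le_iff₀ hδ] at hN
    linarith [ht.1]

/-- Peano existence for a terminal value problem with a bounded Carathéodory right-hand side. -/
lemma exists_terminal_solution {G : ℝ → ℝ → ℝ} {a b : ℝ} {K : NNReal} (hab : a ≤ b)
    (hmeas : ∀ v : ℝ → ℝ, Continuous v →
      AEStronglyMeasurable (fun u => G u (v u)) (volume.restrict (Ioc a b)))
    (hbound : ∀ u ∈ Icc a b, ∀ v, |G u v| ≤ K)
    (hcont : ∀ u ∈ Icc a b, Continuous (G u)) :
    ∃ y : ℝ → ℝ, Continuous y ∧ ∀ t ∈ Icc a b, y t = ∫ u in t..b, G u (y u) := by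
  have hδ : ∀ n : ℕ, (0 : ℝ) < 1 / ((n : ℝ) + 1) := fun n => Nat.one_div_pos_of_nat
  choose v hvlip hv using fun n : ℕ => exists_delayed_solution hab hmeas hbound (hδ n)
  have hvb : ∀ n, ∀ t ∈ Icc a b, v n t ∈ Icc (-(K * (b - a))) (K * (b - a)) := by
    intro n t ht
    rw [mem_Icc, ← abs_le, hv n t ht]
    refine (abs_intervalIntegral_le (C := K) fun u hu => ?_).trans ?_
    · rw [uIoc_of_le ht.2] at hu
      exact hbound u ⟨ht.1.trans hu.1.le, hu.2⟩ _
    · rw [abs_of_nonneg (by linarith [ht.2])]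
      gcongr
      exact ht.1
  let g : ℕ → BoundedContinuousFunction (Icc a b) ℝ := fun n =>
    BoundedContinuousFunction.mkOfCompact
      ⟨fun x => v n x, (hvlip n).continuous.comp continuous_subtype_val⟩
  have hcomp : IsCompact (closure (range g)) := by
    refine BoundedContinuousFunction.arzela_ascoli (Icc (-(K * (b - a))) (K * (b - a)))
      isCompact_Icc _ ?_ ?_
    · rintro _ x ⟨n, rfl⟩
      exact hvb n x x.2
    · apply UniformEquicontinuous.equicontinuous
      apply LipschitzWith.uniformEquicontinuous _ K
      rintro ⟨_, n, rfl⟩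
      exact ((hvlip n).comp (LipschitzWith.subtype_val _)).weaken (by simp)
  obtain ⟨g₀, -, φ, hφ, hlim⟩ := hcomp.tendsto_subseq fun n => subset_closure (mem_range_self n)
  refine ⟨IccExtend hab g₀, g₀.continuous.Icc_extend', fun t ht => ?_⟩
  have hpt : ∀ u ∈ Icc a b, Tendsto (fun n => v (φ n) u) atTop (𝓝 (IccExtend hab g₀ u)) := by
    intro u hu
    rw [IccExtend_of_mem hab _ hu]
    exact ((BoundedContinuousFunction.lipschitz_eval_const (⟨u, hu⟩ : Icc a b)).continuous.tendsto
      g₀).comp hlim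
  have hδlim : Tendsto (fun n => (1 : ℝ) / ((φ n : ℝ) + 1)) atTop (𝓝 0) :=
    tendsto_one_div_add_atTop_nhds_zero_nat.comp hφ.tendsto_atTop
  have hpt' : ∀ u ∈ Icc a b,
      Tendsto (fun n => v (φ n) (u + 1 / ((φ n : ℝ) + 1))) atTop (𝓝 (IccExtend hab g₀ u)) := by
    intro u hu
    refine (hpt u hu).congr_dist ?_
    refine squeeze_zero (fun _ => dist_nonneg) (fun n => (hvlip (φ n)).dist_le_mul _ _) ?_
    have : Tendsto (fun n => (K : ℝ) * dist u (u + 1 / ((φ n : ℝ) + 1))) atTop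
        (𝓝 (K * dist u (u + 0))) :=
      tendsto_const_nhds.mul (tendsto_const_nhds.dist (tendsto_const_nhds.add hδlim))
    simpa using this
  refine tendsto_nhds_unique (hpt t ht) ?_
  simp_rw [hv _ t ht]
  refine intervalIntegral.tendsto_integral_filter_of_dominated_convergence (fun _ => (K : ℝ))
    (Eventually.of_forall fun n => ?_) (Eventually.of_forall fun n => ?_)
    intervalIntegrable_const ?_
  · rw [uIoc_of_le ht.2]
    refine (hmeas (fun u => v (φ n) (u + 1 / ((φ n : ℝ) + 1))) ?_).mono_measure
      (Measure.restrict_mono (Ioc_subset_Ioc_left ht.1) le_rfl)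
    exact (hvlip (φ n)).continuous.comp (by fun_prop)
  · refine Eventually.of_forall fun u hu => hbound u ?_ _
    rw [uIoc_of_le ht.2] at hu
    exact ⟨ht.1.trans hu.1.le, hu.2⟩
  · refine Eventually.of_forall fun u hu => ?_
    rw [uIoc_of_le ht.2] at hu
    have huab : u ∈ Icc a b := ⟨ht.1.trans hu.1.le, hu.2⟩
    exact ((hcont u huab).tendsto _).comp (hpt' u huab)

/-- Measurability, boundedness and sign conditions on the coefficients of the ODE on `[s,1]`. -/
structure BoundedCoeffs (h f : ℝ → ℝ) (s M A : ℝ) : Prop where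
  lt_one : s < 1
  meas : Measurable h
  abs_le : ∀ t ∈ Icc s 1, |h t| ≤ M
  integrable : IntervalIntegrable f volume s 1
  nonneg : ∀ t ∈ Icc s 1, 0 ≤ f t
  le : ∀ t ∈ Icc s 1, f t ≤ A

section

variable {p p' s M A c a b : ℝ} {h f y : ℝ → ℝ}

namespace BoundedCoeffs

lemma intervalIntegrable_h (H : BoundedCoeffs h f s M A) : IntervalIntegrable h volume s 1 := by
  rw [intervalIntegrable_iff_integrableOn_Ioc_of_le H.lt_one.le]
  refine Integrable.of_bound H.meas.aestronglyMeasurable M ?_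
  filter_upwards [ae_restrict_mem measurableSet_Ioc] with u hu
  exact H.abs_le u ⟨hu.1.le, hu.2⟩

lemma intervalIntegrable_rhs (H : BoundedCoeffs h f s M A) (hp : 0 < p) (hsa : s ≤ a)
    (hab : a ≤ b) (hb : b ≤ 1) (hy : ContinuousOn y (Icc a b)) :
    IntervalIntegrable (fun u => p' * ((c - h u) * (max (y u) 0) ^ (1 / p) - f u)) volume a b := by
  have hsub : uIcc a b ⊆ uIcc s 1 := by
    rw [uIcc_of_le hab, uIcc_of_le H.lt_one.le]; exact Icc_subset_Icc hsa hb
  have hc : ContinuousOn (fun u => (max (y u) 0) ^ (1 / p)) (uIcc a b) := by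
    rw [uIcc_of_le hab]
    exact (hy.sup continuousOn_const).rpow_const fun _ _ => Or.inr (by positivity)
  exact ((((intervalIntegrable_const (c := c)).sub
    (H.intervalIntegrable_h.mono_set hsub)).mul_continuousOn hc).sub
    (H.integrable.mono_set hsub)).const_mul p'

lemma intervalIntegrable_mul (H : BoundedCoeffs h f s M A) {φ : ℝ → ℝ} (hsa : s ≤ a)
    (hab : a ≤ b) (hb : b ≤ 1) (hφ : ContinuousOn φ (Icc a b)) :
    IntervalIntegrable (fun u => f u * φ u) volume a b := by
  have hsub : uIcc a b ⊆ uIcc s 1 := by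
    rw [uIcc_of_le hab, uIcc_of_le H.lt_one.le]; exact Icc_subset_Icc hsa hb
  exact (H.integrable.mono_set hsub).mul_continuousOn (by rwa [uIcc_of_le hab])

lemma intervalIntegrable_const_sub (H : BoundedCoeffs h f s M A) (hsa : s ≤ a)
    (hab : a ≤ b) (hb : b ≤ 1) :
    IntervalIntegrable (fun u => c - h u) volume a b := by
  have hsub : uIcc a b ⊆ uIcc s 1 := by
    rw [uIcc_of_le hab, uIcc_of_le H.lt_one.le]; exact Icc_subset_Icc hsa hb
  exact intervalIntegrable_const.sub (H.intervalIntegrable_h.mono_set hsub)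

lemma abs_rhs_le (H : BoundedCoeffs h f s M A) (hp' : 0 < p') {u w r : ℝ} (hu : u ∈ Icc s 1)
    (hw : 0 ≤ w) (hwr : w ≤ r) :
    |p' * ((c - h u) * w - f u)| ≤ p' * ((|c| + M) * r + A) := by
  rw [abs_mul, abs_of_pos hp']
  gcongr
  have h1 : |c - h u| ≤ |c| + M := (abs_sub _ _).trans (by linarith [H.abs_le u hu])
  calc |(c - h u) * w - f u| ≤ |(c - h u) * w| + |f u| := abs_sub _ _
    _ ≤ (|c| + M) * r + A := by
      rw [abs_mul, abs_of_nonneg hw, abs_of_nonneg (H.nonneg u hu)]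
      exact add_le_add (mul_le_mul h1 hwr hw ((abs_nonneg _).trans h1)) (H.le u hu)

end BoundedCoeffs

lemma IsCaraSol.sub_eq (H : BoundedCoeffs h f s M A) (hp : 0 < p)
    (hy : IsCaraSol p p' h f c s 1 y) (hsa : s ≤ a) (hab : a ≤ b) (hb : b ≤ 1) :
    y b = y a + ∫ u in a..b, p' * ((c - h u) * (max (y u) 0) ^ (1 / p) - f u) := by
  rw [hy.2 a ⟨hsa, hab.trans hb⟩, hy.2 b ⟨hsa.trans hab, hb⟩, add_assoc,
    integral_add_adjacent_intervals]
  · exact H.intervalIntegrable_rhs hp le_rfl hsa (hab.trans hb)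
      (hy.1.mono (Icc_subset_Icc_right (hab.trans hb)))
  · exact H.intervalIntegrable_rhs hp hsa hab hb (hy.1.mono (Icc_subset_Icc hsa hb))

/-- In the variable `y ^ (1 / p')` the ODE has a right-hand side which increases with `y`. -/
lemma IsCaraSol.rpow_sub_eq (H : BoundedCoeffs h f s M A) (hpp : p.HolderConjugate p')
    (hy : IsCaraSol p p' h f c s 1 y) (hsa : s ≤ a) (hab : a ≤ b) (hb : b ≤ 1)
    (hpos : ∀ t ∈ Icc a b, 0 < y t) :
    y b ^ (1 / p') - y a ^ (1 / p') = ∫ u in a..b, (c - h u - f u * y u ^ (-(1 / p))) := by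
  have hp : 0 < p := hpp.pos
  have hp' : 0 < p' := hpp.symm.pos
  have hyc : ContinuousOn y (Icc a b) := hy.1.mono (Icc_subset_Icc hsa hb)
  obtain ⟨x₀, hx₀, hmin⟩ := isCompact_Icc.exists_isMinOn (nonempty_Icc.2 hab) hyc
  obtain ⟨x₁, hx₁, hmax⟩ := isCompact_Icc.exists_isMaxOn (nonempty_Icc.2 hab) hyc
  rw [rpow_sub_rpow_eq_integral (y := y) (m := y x₀) (N := y x₁)
    (L := p' * ((|c| + M) * (y x₁) ^ (1 / p) + A)) hab (hpos x₀ hx₀)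
    (H.intervalIntegrable_rhs (p' := p') (c := c) hp hsa hab hb hyc) ?_
    (fun t ht => hy.sub_eq H hp hsa ht.1 (ht.2.trans hb)) (fun t ht => ⟨hmin ht, hmax ht⟩)]
  · apply intervalIntegral.integral_congr
    intro u hu
    rw [uIcc_of_le hab] at hu
    have hyu := hpos u hu
    have he : 1 / p' - 1 = -(1 / p) := by
      have := hpp.inv_add_inv_eq_one
      simp only [one_div]; linarith
    have hm : y u ^ (-(1 / p)) * y u ^ (1 / p) = 1 := by
      rw [← Real.rpow_add hyu]; simp
    simp only [he, max_eq_left hyu.le]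
    field_simp
    linear_combination (c - h u) * hm
  · intro u hu
    have hyu := hpos u hu
    refine H.abs_rhs_le hp' ⟨hsa.trans hu.1, hu.2.trans hb⟩ (by positivity) ?_
    rw [max_eq_left hyu.le]
    exact Real.rpow_le_rpow hyu.le (hmax hu) (by positivity)

/-- Comparison of a solution vanishing at `1` with a subsolution lying above it at `1`. -/
lemma IsCaraSol.rpow_le_of_subsolution (H : BoundedCoeffs h f s M A)
    (hpp : p.HolderConjugate p') (hy : IsCaraSol p p' h f c s 1 y)
    (hpos : ∀ t ∈ Ioo s 1, 0 < y t) (hy1 : y 1 = 0) {Y : ℝ → ℝ} {c' e : ℝ}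
    (hY : ContinuousOn Y (Icc s 1)) (hYpos : ∀ t ∈ Ioo s 1, 0 < Y t) (hY1 : 0 ≤ Y 1)
    (he : 0 ≤ e) (hce : c' ≤ c + e)
    (hsub : ∀ t₁ t₂, s < t₁ → t₁ ≤ t₂ → t₂ < 1 → Y t₂ ^ (1 / p') - Y t₁ ^ (1 / p') ≤
      ∫ u in t₁..t₂, (c' - h u - f u * Y u ^ (-(1 / p)))) :
    ∀ t ∈ Icc s 1, y t ^ (1 / p') ≤ Y t ^ (1 / p') + e * (1 - t) := by
  have hp : 0 < p := hpp.pos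
  have hp' : 0 < p' := hpp.symm.pos
  have hyr : ContinuousOn (fun t => y t ^ (1 / p')) (Icc s 1) :=
    hy.1.rpow_const fun _ _ => Or.inr (by positivity)
  have hYr : ContinuousOn (fun t => Y t ^ (1 / p') + e * (1 - t)) (Icc s 1) :=
    (hY.rpow_const fun _ _ => Or.inr (by positivity)).add (by fun_prop)
  have key : ∀ t ∈ Ioo s 1, y t ^ (1 / p') ≤ Y t ^ (1 / p') + e * (1 - t) := by
    intro t ht
    by_contra! hcon
    have hsubset : Icc t 1 ⊆ Icc s 1 := Icc_subset_Icc_left ht.1.le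
    have := pos_of_continuation (w := fun t => y t ^ (1 / p') - (Y t ^ (1 / p') + e * (1 - t)))
      ht.2.le ((hyr.sub hYr).mono hsubset) (sub_pos.2 hcon) ?_
    · have h0 : (0 : ℝ) ^ (1 / p') = 0 := Real.zero_rpow (by positivity)
      simp only [hy1, h0] at this
      have : 0 ≤ Y 1 ^ (1 / p') := by positivity
      linarith
    · intro t₂ ht₂ hw
      have hI : ∀ u ∈ Icc t t₂, u ∈ Ioo s 1 := fun u hu =>
        ⟨ht.1.trans_le hu.1, hu.2.trans_lt ht₂.2⟩
      have hI' : Icc t t₂ ⊆ Icc s 1 := fun u hu => Ioo_subset_Icc_self (hI u hu)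
      have e1 := hy.rpow_sub_eq H hpp ht.1.le ht₂.1.le ht₂.2.le fun u hu => hpos u (hI u hu)
      have e2 := hsub t t₂ ht.1 ht₂.1.le ht₂.2
      have hint : ∀ (k : ℝ) (v : ℝ → ℝ), ContinuousOn v (Icc s 1) → (∀ u ∈ Ioo s 1, 0 < v u) →
          IntervalIntegrable (fun u => k - h u - f u * v u ^ (-(1 / p))) volume t t₂ :=
        fun k v hv hv0 => (H.intervalIntegrable_const_sub ht.1.le ht₂.1.le ht₂.2.le).sub
          (H.intervalIntegrable_mul ht.1.le ht₂.1.le ht₂.2.le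
            ((hv.mono hI').rpow_const fun u hu => Or.inl (hv0 u (hI u hu)).ne'))
      have e3 : ∫ u in t..t₂, (c' - h u - f u * Y u ^ (-(1 / p))) ≤
          ∫ u in t..t₂, (c - h u - f u * y u ^ (-(1 / p)) + e) := by
        apply intervalIntegral.integral_mono_on ht₂.1.le (hint c' Y hY hYpos)
          ((hint c y hy.1 hpos).add intervalIntegrable_const)
        intro u hu
        have hu' := hI u hu
        have hYy : Y u ≤ y u := by
          have h1 := hw u hu
          have h2 : 0 ≤ e * (1 - u) := mul_nonneg he (by linarith [hu'.2])
          refine le_of_not_gt fun hlt => ?_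
          have := Real.rpow_le_rpow (hpos u hu').le hlt.le (z := 1 / p') (by positivity)
          linarith
        have h3 : y u ^ (-(1 / p)) ≤ Y u ^ (-(1 / p)) :=
          Real.rpow_le_rpow_of_nonpos (hYpos u hu') hYy (neg_nonpos.2 (by positivity))
        have h4 := mul_le_mul_of_nonneg_left h3 (H.nonneg u (hI' hu))
        linarith
      rw [intervalIntegral.integral_add (hint c y hy.1 hpos) intervalIntegrable_const,
        ← e1, intervalIntegral.integral_const, smul_eq_mul] at e3
      show y t ^ (1 / p') - (Y t ^ (1 / p') + e * (1 - t)) ≤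
        y t₂ ^ (1 / p') - (Y t₂ ^ (1 / p') + e * (1 - t₂))
      linarith
  have hcl : closure (Ioo s 1) = Icc s 1 := closure_Ioo H.lt_one.ne
  intro t ht
  exact le_on_closure key (by rwa [hcl]) (by rwa [hcl]) (by rwa [hcl])

/-- A solution that vanishes at `1` is positive on `(s,1)`. -/
lemma IsCaraSol.pos_of_terminal_zero (H : BoundedCoeffs h f s M A)
    (hpp : p.HolderConjugate p') (hfpos : ∀ t ∈ Ioo s 1, 0 < f t)
    (hlsc : LowerSemicontinuousOn f (Ioo s 1)) (hy : IsCaraSol p p' h f c s 1 y)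
    (hy1 : y 1 = 0) : ∀ t ∈ Ioo s 1, 0 < y t := by
  have hp : 0 < p := hpp.pos
  have hp' : 0 < p' := hpp.symm.pos
  intro t ht
  by_contra! hyt
  have hneg : ∃ t₁ ∈ Ioo t 1, y t₁ < 0 := by
    set η := f t / 2 with hη
    have hηpos : 0 < η := half_pos (hfpos t ht)
    have hev1 : ∀ᶠ u in 𝓝 t, η < f u := by
      have := hlsc t ht η (half_lt_self (hfpos t ht))
      rwa [nhdsWithin_eq_nhds.2 (Ioo_mem_nhds ht.1 ht.2)] at this
    have hyc : ContinuousAt y t := hy.1.continuousAt (Icc_mem_nhds ht.1 ht.2)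
    have hcont : ContinuousAt (fun u => (|c| + M) * (max (y u) 0) ^ (1 / p)) t :=
      continuousAt_const.mul
        ((hyc.sup continuousAt_const).rpow_const (Or.inr (by positivity)))
    have hev2 : ∀ᶠ u in 𝓝 t, (|c| + M) * (max (y u) 0) ^ (1 / p) < η / 2 := by
      apply hcont.eventually_lt continuousAt_const
      have h0 : (0 : ℝ) ^ (1 / p) = 0 := Real.zero_rpow (by positivity)
      rw [max_eq_right hyt, h0]
      linarith
    obtain ⟨ε, hε, hball⟩ := Metric.eventually_nhds_iff.1 (hev1.and hev2)
    obtain ⟨t₁, ht₁, ht₁'⟩ := exists_between (lt_min ht.2 (show t < t + ε by linarith))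
    have ht₁1 : t₁ < 1 := ht₁'.trans_le (min_le_left _ _)
    have ht₁ε : t₁ < t + ε := ht₁'.trans_le (min_le_right _ _)
    refine ⟨t₁, ⟨ht₁, ht₁1⟩, ?_⟩
    rw [hy.sub_eq H hp ht.1.le ht₁.le ht₁1.le]
    have : ∫ u in t..t₁, p' * ((c - h u) * (max (y u) 0) ^ (1 / p) - f u) ≤
        ∫ u in t..t₁, p' * (-(η / 2)) := by
      apply intervalIntegral.integral_mono_on ht₁.le
        (H.intervalIntegrable_rhs hp ht.1.le ht₁.le ht₁1.le
          (hy.1.mono (Icc_subset_Icc ht.1.le ht₁1.le))) intervalIntegrable_const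
      intro u hu
      obtain ⟨h1, h2⟩ := hball (show dist u t < ε by
        rw [Real.dist_eq, abs_of_nonneg (by linarith [hu.1])]; linarith [hu.2])
      have h3 : c - h u ≤ |c| + M := by
        have := abs_le.1 (H.abs_le u ⟨ht.1.le.trans hu.1, hu.2.trans ht₁1.le⟩)
        linarith [le_abs_self c]
      have h4 : (c - h u) * (max (y u) 0) ^ (1 / p) ≤ (|c| + M) * (max (y u) 0) ^ (1 / p) :=
        mul_le_mul_of_nonneg_right h3 (by positivity)
      gcongr
      linarith
    rw [intervalIntegral.integral_const, smul_eq_mul] at this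
    have hprod : 0 < (t₁ - t) * (p' * (η / 2)) := by
      have := sub_pos.2 ht₁
      positivity
    linarith
  obtain ⟨t₁, ht₁, hyt₁⟩ := hneg
  have hst₁ : s < t₁ := ht.1.trans ht₁.1
  have := pos_of_continuation (w := fun u => -y u) ht₁.2.le
    (hy.1.neg.mono (Icc_subset_Icc_left hst₁.le)) (neg_pos.2 hyt₁) ?_
  · simp [hy1] at this
  · intro t₂ ht₂ hw
    rw [neg_le_neg_iff, hy.sub_eq H hp hst₁.le ht₂.1.le ht₂.2.le]
    have hle : ∫ u in t₁..t₂, p' * ((c - h u) * (max (y u) 0) ^ (1 / p) - f u) ≤ 0 := by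
      rw [← neg_nonneg, ← intervalIntegral.integral_neg]
      apply intervalIntegral.integral_nonneg ht₂.1.le
      intro u hu
      have h0 : (0 : ℝ) ^ (1 / p) = 0 := Real.zero_rpow (by positivity)
      have hfu := H.nonneg u ⟨hst₁.le.trans hu.1, hu.2.trans ht₂.2.le⟩
      have hyu : y u ≤ 0 := by linarith [hw u hu]
      rw [max_eq_right hyu, h0]
      have := mul_nonneg hp'.le hfu
      linarith
    linarith

/-- Every terminal value problem `y 1 = 0` has a solution. -/
lemma BoundedCoeffs.exists_isCaraSol (H : BoundedCoeffs h f s M A) (hpp : p.HolderConjugate p')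
    (hs : 0 ≤ s) (c : ℝ) : ∃ y, IsCaraSol p p' h f c s 1 y ∧ y 1 = 0 := by
  have hp : 0 < p := hpp.pos
  have hp' : 0 < p' := hpp.symm.pos
  have h1mem : (1 : ℝ) ∈ Icc s 1 := right_mem_Icc.2 H.lt_one.le
  have hM : 0 ≤ M := (_root_.abs_nonneg _).trans (H.abs_le 1 h1mem)
  have hA : 0 ≤ A := (H.nonneg 1 h1mem).trans (H.le 1 h1mem)
  obtain ⟨R, hR0, hR⟩ : ∃ R : ℝ, 0 ≤ R ∧ p' * ((|c| + M) * R ^ (1 / p) + A) ≤ R := by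
    set X := 1 + p' * (|c| + M + A) with hX
    have hX1 : 1 ≤ X := by
      have : 0 ≤ p' * (|c| + M + A) := by positivity
      linarith
    have hX0 : 0 < X := by linarith
    refine ⟨X ^ p', by positivity, ?_⟩
    rw [← Real.rpow_mul hX0.le]
    have hexp : X ^ p' = X * X ^ (p' * (1 / p)) := by
      have : p' = 1 + p' * (1 / p) := by
        have := hpp.inv_add_inv_eq_one
        field_simp at this ⊢
        linarith
      conv_lhs => rw [this, Real.rpow_add hX0, Real.rpow_one]
    have hge : 1 ≤ X ^ (p' * (1 / p)) := Real.one_le_rpow hX1 (by positivity)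
    rw [hexp]
    calc p' * ((|c| + M) * X ^ (p' * (1 / p)) + A)
        ≤ p' * ((|c| + M) * X ^ (p' * (1 / p)) + A * X ^ (p' * (1 / p))) := by
          gcongr; exact le_mul_of_one_le_right hA hge
      _ = (p' * (|c| + M + A)) * X ^ (p' * (1 / p)) := by ring
      _ ≤ X * X ^ (p' * (1 / p)) := by gcongr; linarith
  have htr : ∀ v : ℝ, (max (min v R) 0) ^ (1 / p) ≤ R ^ (1 / p) := fun v =>
    Real.rpow_le_rpow (le_max_right _ _) (max_le (min_le_right _ _) hR0) (by positivity)
  obtain ⟨y, hyc, hy⟩ := exists_terminal_solution (a := s) (b := 1) (K := Real.toNNReal R)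
    (G := fun u v => -(p' * ((c - h u) * (max (min v R) 0) ^ (1 / p) - f u))) H.lt_one.le
    (by
      intro v hv
      have h1 : Continuous fun u => (max (min (v u) R) 0) ^ (1 / p) :=
        ((hv.min continuous_const).max continuous_const).rpow_const
          fun _ => Or.inr (by positivity)
      have h2 : AEStronglyMeasurable f (volume.restrict (Ioc s 1)) :=
        H.integrable.1.aestronglyMeasurable
      exact (((aestronglyMeasurable_const.sub H.meas.aestronglyMeasurable).mul
        h1.aestronglyMeasurable).sub h2).const_mul p' |>.neg)
    (by
      intro u hu v
      rw [abs_neg, Real.coe_toNNReal _ hR0]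
      exact (H.abs_rhs_le hp' hu (by positivity) (htr v)).trans hR)
    (by
      intro u hu
      have h1 : Continuous fun v : ℝ => (max (min v R) 0) ^ (1 / p) :=
        ((continuous_id.min continuous_const).max continuous_const).rpow_const
          fun _ => Or.inr (by positivity)
      exact ((h1.const_mul _).sub continuous_const |>.const_mul _).neg)
  have hyR : ∀ t ∈ Icc s 1, y t ≤ R := by
    intro t ht
    refine (le_abs_self _).trans ?_
    rw [hy t ht]
    refine (abs_intervalIntegral_le (C := R) fun u hu => ?_).trans ?_
    · rw [uIoc_of_le ht.2] at hu
      rw [abs_neg]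
      exact (H.abs_rhs_le hp' ⟨ht.1.trans hu.1.le, hu.2⟩ (by positivity) (htr _)).trans hR
    · rw [abs_of_nonneg (by linarith [ht.2])]
      exact mul_le_of_le_one_right hR0 (by linarith [ht.1])
  have hy' : ∀ t ∈ Icc s 1, y t =
      -∫ u in t..1, p' * ((c - h u) * (max (y u) 0) ^ (1 / p) - f u) := by
    intro t ht
    rw [hy t ht, ← intervalIntegral.integral_neg]
    apply intervalIntegral.integral_congr
    intro u hu
    rw [uIcc_of_le ht.2] at hu
    simp only [min_eq_left (hyR u ⟨ht.1.trans hu.1, hu.2⟩)]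
  refine ⟨y, ⟨hyc.continuousOn, fun t ht => ?_⟩, by rw [hy 1 h1mem]; simp⟩
  rw [hy' t ht, hy' s (left_mem_Icc.2 H.lt_one.le), ← integral_add_adjacent_intervals
    (H.intervalIntegrable_rhs hp le_rfl ht.1 ht.2 hyc.continuousOn)
    (H.intervalIntegrable_rhs hp ht.1 ht.2 le_rfl hyc.continuousOn)]
  ring

lemma IsCaraSol.nonneg (H : BoundedCoeffs h f s M A) (hy : IsCaraSol p p' h f c s 1 y)
    (hpos : ∀ t ∈ Ioo s 1, 0 < y t) : ∀ t ∈ Icc s 1, 0 ≤ y t := by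
  have hcl : closure (Ioo s 1) = Icc s 1 := closure_Ioo H.lt_one.ne
  intro t ht
  exact le_on_closure (f := fun _ => (0 : ℝ)) (fun u hu => (hpos u hu).le) continuousOn_const
    (by rw [hcl]; exact hy.1) (by rwa [hcl])

/-- Comparison of two positive solutions vanishing at `1`. -/
lemma IsCaraSol.rpow_le (H : BoundedCoeffs h f s M A) (hpp : p.HolderConjugate p')
    (hy : IsCaraSol p p' h f c s 1 y) (hpos : ∀ t ∈ Ioo s 1, 0 < y t) (hy1 : y 1 = 0)
    {Y : ℝ → ℝ} {c' e : ℝ} (hY : IsCaraSol p p' h f c' s 1 Y) (hYpos : ∀ t ∈ Ioo s 1, 0 < Y t)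
    (hY1 : Y 1 = 0) (he : 0 ≤ e) (hce : c' ≤ c + e) :
    ∀ t ∈ Icc s 1, y t ^ (1 / p') ≤ Y t ^ (1 / p') + e * (1 - t) :=
  hy.rpow_le_of_subsolution H hpp hpos hy1 hY.1 hYpos hY1.ge he hce
    fun _ _ h1 h12 h2 => (hY.rpow_sub_eq H hpp h1.le h12 h2.le
      fun u hu => hYpos u ⟨h1.trans_le hu.1, hu.2.trans_lt h2⟩).le

lemma IsPosBVPSol.eqOn (H : BoundedCoeffs h f s M A) (hpp : p.HolderConjugate p') {Y : ℝ → ℝ}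
    (hy : IsPosBVPSol p p' h f c s 1 y) (hY : IsPosBVPSol p p' h f c s 1 Y) :
    EqOn y Y (Icc s 1) := by
  intro t ht
  have hp' : 0 < 1 / p' := one_div_pos.2 hpp.symm.pos
  have h1 := hy.1.rpow_le H hpp hy.2.2.2 hy.2.2.1 hY.1 hY.2.2.2 hY.2.2.1 le_rfl (by simp) t ht
  have h2 := hY.1.rpow_le H hpp hY.2.2.2 hY.2.2.1 hy.1 hy.2.2.2 hy.2.2.1 le_rfl (by simp) t ht
  have hy0 := hy.1.nonneg H hy.2.2.2 t ht
  have hY0 := hY.1.nonneg H hY.2.2.2 t ht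
  rw [zero_mul, add_zero, Real.rpow_le_rpow_iff (by assumption) (by assumption) hp'] at h1 h2
  exact le_antisymm h1 h2

lemma IsCaraSol.isPosBVPSol (H : BoundedCoeffs h f s M A) (hpp : p.HolderConjugate p')
    (hy : IsCaraSol p p' h f c s 1 y) (hpos : ∀ t ∈ Ioo s 1, 0 < y t) (hy1 : y 1 = 0)
    (hys : y s ^ (1 / p') ≤ 0) : IsPosBVPSol p p' h f c s 1 y := by
  have hp' : 0 < 1 / p' := one_div_pos.2 hpp.symm.pos
  have h0 := hy.nonneg H hpos s (left_mem_Icc.2 H.lt_one.le)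
  refine ⟨hy, h0.antisymm' (le_of_not_gt fun hlt => ?_), hy1, hpos⟩
  exact absurd (Real.rpow_pos_of_pos hlt (1 / p')) (not_lt.2 hys)

/-- A positive solution can only exist for speeds above the mean of `h`. -/
lemma IsPosBVPSol.average_lt (H : BoundedCoeffs h f s M A) (hpp : p.HolderConjugate p')
    (hfpos : ∀ t ∈ Ioo s 1, 0 < f t) (hy : IsPosBVPSol p p' h f c s 1 y) :
    (∫ t in s..1, h t) / (1 - s) < c := by
  have hp' : 0 < 1 / p' := one_div_pos.2 hpp.symm.pos
  have hs1 := H.lt_one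
  have hch : IntervalIntegrable (fun u => c - h u) volume s 1 :=
    H.intervalIntegrable_const_sub le_rfl hs1.le le_rfl
  have hchi : ∀ x y, s ≤ x → x ≤ y → y ≤ 1 → IntervalIntegrable (fun u => c - h u) volume x y :=
    fun x y hx hxy hy => H.intervalIntegrable_const_sub hx hxy hy
  set Q : ℝ → ℝ := fun t => y t ^ (1 / p') - ∫ u in s..t, (c - h u) with hQ
  have hQc : ContinuousOn Q (Icc s 1) := by
    refine (hy.1.1.rpow_const fun _ _ => Or.inr hp'.le).sub ?_
    have := continuousOn_primitive_interval' hch left_mem_uIcc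
    rwa [uIcc_of_le hs1.le] at this
  have hfy : ∀ t₁ t₂, s < t₁ → t₁ ≤ t₂ → t₂ < 1 →
      IntervalIntegrable (fun u => f u * y u ^ (-(1 / p))) volume t₁ t₂ := by
    intro t₁ t₂ h1 h12 h2
    refine H.intervalIntegrable_mul h1.le h12 h2.le
      ((hy.1.1.mono (Icc_subset_Icc h1.le h2.le)).rpow_const fun u hu => Or.inl ?_)
    exact (hy.2.2.2 u ⟨h1.trans_le hu.1, hu.2.trans_lt h2⟩).ne'
  have hQeq : ∀ t₁ t₂, s < t₁ → t₁ ≤ t₂ → t₂ < 1 →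
      Q t₂ = Q t₁ - ∫ u in t₁..t₂, f u * y u ^ (-(1 / p)) := by
    intro t₁ t₂ h1 h12 h2
    have e1 := hy.1.rpow_sub_eq H hpp h1.le h12 h2.le
      fun u hu => hy.2.2.2 u ⟨h1.trans_le hu.1, hu.2.trans_lt h2⟩
    rw [intervalIntegral.integral_sub (hchi t₁ t₂ h1.le h12 h2.le) (hfy t₁ t₂ h1 h12 h2)] at e1
    have e2 := integral_add_adjacent_intervals (hchi s t₁ le_rfl h1.le (h12.trans h2.le))
      (hchi t₁ t₂ h1.le h12 h2.le)
    simp only [hQ]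
    linarith
  have hposint : ∀ u ∈ Ioo s 1, 0 < f u * y u ^ (-(1 / p)) := fun u hu =>
    mul_pos (hfpos u hu) (Real.rpow_pos_of_pos (hy.2.2.2 u hu) _)
  have hQmono : ∀ t₁ t₂, s < t₁ → t₁ ≤ t₂ → t₂ < 1 → Q t₂ ≤ Q t₁ := by
    intro t₁ t₂ h1 h12 h2
    rw [hQeq t₁ t₂ h1 h12 h2, sub_le_self_iff]
    exact intervalIntegral.integral_nonneg h12 fun u hu =>
      (hposint u ⟨h1.trans_le hu.1, hu.2.trans_lt h2⟩).le
  obtain ⟨x₀, hx₀s, hx₀1⟩ := exists_between hs1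
  obtain ⟨x₁, hx₁, hx₁1⟩ := exists_between hx₀1
  have hstrict : Q x₁ < Q x₀ := by
    rw [hQeq x₀ x₁ hx₀s hx₁.le hx₁1, sub_lt_self_iff]
    exact intervalIntegral.intervalIntegral_pos_of_pos_on (hfy x₀ x₁ hx₀s hx₁.le hx₁1)
      (fun u hu => hposint u ⟨hx₀s.trans hu.1, hu.2.trans hx₁1⟩) hx₁
  have hr : Q 1 ≤ Q x₁ := by
    have hcl : closure (Ioo x₁ 1) = Icc x₁ 1 := closure_Ioo hx₁1.ne
    refine le_on_closure (s := Ioo x₁ 1) (f := Q) (g := fun _ => Q x₁)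
      (fun u hu => hQmono x₁ u (hx₀s.trans hx₁) hu.1.le hu.2) ?_ continuousOn_const ?_
    · rw [hcl]; exact hQc.mono (Icc_subset_Icc_left (hx₀s.trans hx₁).le)
    · rw [hcl]; exact right_mem_Icc.2 hx₁1.le
  have hl : Q x₀ ≤ Q s := by
    have hcl : closure (Ioo s x₀) = Icc s x₀ := closure_Ioo hx₀s.ne
    refine le_on_closure (s := Ioo s x₀) (f := fun _ => Q x₀) (g := Q)
      (fun u hu => hQmono u x₀ hu.1 hu.2.le hx₀1) continuousOn_const ?_ ?_
    · rw [hcl]; exact hQc.mono (Icc_subset_Icc_right hx₀1.le)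
    · rw [hcl]; exact left_mem_Icc.2 hx₀s.le
  have hlt : Q 1 < Q s := by linarith
  simp only [hQ, hy.2.1, hy.2.2.1, intervalIntegral.integral_same] at hlt
  rw [intervalIntegral.integral_sub intervalIntegrable_const H.intervalIntegrable_h,
    intervalIntegral.integral_const, smul_eq_mul] at hlt
  rw [div_lt_iff₀ (by linarith)]
  linarith

/-- A positive solution can only exist for speeds not below `h s`. -/
lemma IsPosBVPSol.le_speed (H : BoundedCoeffs h f s M A) (hpp : p.HolderConjugate p')
    (hhc : ContinuousAt h s) (hy : IsPosBVPSol p p' h f c s 1 y) : h s ≤ c := by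
  have hp : 0 < p := hpp.pos
  have hp' : 0 < p' := hpp.symm.pos
  by_contra! hlt
  obtain ⟨ε, hε, hball⟩ := Metric.eventually_nhds_iff.1 (hhc.eventually (lt_mem_nhds hlt))
  obtain ⟨t, hst, ht⟩ := exists_between (lt_min H.lt_one (show s < s + ε by linarith))
  have ht1 : t < 1 := ht.trans_le (min_le_left _ _)
  have htε : t < s + ε := ht.trans_le (min_le_right _ _)
  have hyt := hy.2.2.2 t ⟨hst, ht1⟩
  rw [hy.1.sub_eq H hp le_rfl hst.le ht1.le, hy.2.1, zero_add] at hyt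
  have hle : ∫ u in s..t, p' * ((c - h u) * (max (y u) 0) ^ (1 / p) - f u) ≤ 0 := by
    rw [← neg_nonneg, ← intervalIntegral.integral_neg]
    apply intervalIntegral.integral_nonneg hst.le
    intro u hu
    have hfu := H.nonneg u ⟨hu.1, hu.2.trans ht1.le⟩
    have hhu : c < h u := hball (by
      rw [Real.dist_eq, abs_of_nonneg (by linarith [hu.1])]; linarith [hu.2])
    have h1 : 0 ≤ (h u - c) * (max (y u) 0) ^ (1 / p) :=
      mul_nonneg (by linarith) (by positivity)
    have := mul_nonneg hp'.le (add_nonneg h1 hfu)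
    linarith
  linarith

lemma exists_slope_eq (hpp : p.HolderConjugate p') {μ : ℝ} (hμ : 0 < μ) :
    ∃ k : ℝ, 0 < k ∧
      k + μ * k ^ (-(p' - 1)) = p' ^ (1 / p') * p ^ (1 / p) * μ ^ (1 / p') := by
  have hp : 0 < p := hpp.pos
  have hp' : 0 < p' := hpp.symm.pos
  have hq : 0 < p' - 1 := hpp.symm.sub_one_pos
  have hpq : (p' - 1) * p = p' := by
    have := hpp.inv_add_inv_eq_one
    field_simp at this
    linarith
  refine ⟨((p' - 1) * μ) ^ (1 / p'), by positivity, ?_⟩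
  set k := ((p' - 1) * μ) ^ (1 / p') with hk
  have hk0 : 0 < k := by positivity
  have hkp : k ^ p' = (p' - 1) * μ := by
    rw [hk, ← Real.rpow_mul (by positivity), one_div_mul_cancel hp'.ne', Real.rpow_one]
  have h1 : μ * k ^ (-(p' - 1)) * (p' - 1) = k := by
    have : k ^ (-(p' - 1)) = k / k ^ p' := by
      rw [show -(p' - 1) = 1 - p' by ring, Real.rpow_sub hk0, Real.rpow_one]
    rw [this, hkp]
    field_simp
  have h2 : k + μ * k ^ (-(p' - 1)) = k * p := by
    have h3 : (μ * k ^ (-(p' - 1))) * (p' - 1) * p = k * p := by rw [h1]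
    have h4 : (μ * k ^ (-(p' - 1))) * ((p' - 1) * p) = k * p := by rw [← h3]; ring
    rw [hpq] at h4
    linarith
  rw [h2, hk, Real.mul_rpow hq.le hμ.le]
  have h5 : p' ^ (1 / p') = (p' - 1) ^ (1 / p') * p ^ (1 / p') := by
    rw [← Real.mul_rpow hq.le hp.le, hpq]
  have h6 : p ^ (1 / p') * p ^ (1 / p) = p := by
    rw [← Real.rpow_add hp]
    have := hpp.inv_add_inv_eq_one
    rw [show 1 / p' + 1 / p = 1 by simp only [one_div]; linarith, Real.rpow_one]
  rw [h5]
  linear_combination (-(p' - 1) ^ (1 / p') * μ ^ (1 / p')) * h6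

/-- A linear subsolution forces the terminal solution to vanish at `s`. -/
lemma BoundedCoeffs.exists_isPosBVPSol (H : BoundedCoeffs h f s M A)
    (hpp : p.HolderConjugate p') (hs : 0 ≤ s) (hfpos : ∀ t ∈ Ioo s 1, 0 < f t)
    (hlsc : LowerSemicontinuousOn f (Ioo s 1)) {hM μ k : ℝ} (hhM : ∀ t ∈ Icc s 1, h t ≤ hM)
    (hfμ : ∀ t ∈ Ioo s 1, f t ≤ μ * (t - s) ^ (p' - 1)) (hk : 0 < k)
    (hc : hM + (k + μ * k ^ (-(p' - 1))) ≤ c) :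
    ∃ y, IsPosBVPSol p p' h f c s 1 y := by
  have hp : 0 < p := hpp.pos
  have hp' : 0 < p' := hpp.symm.pos
  have hs1 := H.lt_one
  obtain ⟨y, hy, hy1⟩ := H.exists_isCaraSol hpp hs c
  have hpos := hy.pos_of_terminal_zero H hpp hfpos hlsc hy1
  refine ⟨y, hy.isPosBVPSol H hpp hpos hy1 ?_⟩
  have hexp : p' * (1 / p) = p' - 1 := by
    have := hpp.inv_add_inv_eq_one
    field_simp at this ⊢
    linarith
  have hY0 : ∀ t, s ≤ t → 0 ≤ k * (t - s) := fun t ht => mul_nonneg hk.le (by linarith)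
  have hYr : ∀ t, s ≤ t → ((k * (t - s)) ^ p') ^ (1 / p') = k * (t - s) := fun t ht => by
    rw [← Real.rpow_mul (hY0 t ht), mul_one_div_cancel hp'.ne', Real.rpow_one]
  have hYc : Continuous fun t => (k * (t - s)) ^ p' :=
    (continuous_const.mul (continuous_id.sub continuous_const)).rpow_const
      fun _ => Or.inr hp'.le
  have hYpos : ∀ t, s < t → 0 < (k * (t - s)) ^ p' := fun t ht =>
    Real.rpow_pos_of_pos (mul_pos hk (by linarith)) _
  have := hy.rpow_le_of_subsolution H hpp hpos hy1 (Y := fun t => (k * (t - s)) ^ p')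
    (c' := c) (e := 0) hYc.continuousOn (fun t ht => hYpos t ht.1) (hYpos 1 hs1).le le_rfl
    (by simp) ?_ s (left_mem_Icc.2 hs1.le)
  · have hYs := hYr s le_rfl
    simp only [sub_self, mul_zero, zero_mul, add_zero] at this hYs
    exact this.trans hYs.le
  · intro t₁ t₂ h1 h12 h2
    simp only [hYr t₁ h1.le, hYr t₂ (h1.le.trans h12)]
    have hint : IntervalIntegrable
        (fun u => c - h u - f u * ((k * (u - s)) ^ p') ^ (-(1 / p))) volume t₁ t₂ :=
      (H.intervalIntegrable_const_sub h1.le h12 h2.le).sub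
        (H.intervalIntegrable_mul h1.le h12 h2.le (hYc.continuousOn.rpow_const
          fun u hu => Or.inl (hYpos u (h1.trans_le hu.1)).ne'))
    have hmono : ∫ u in t₁..t₂, k ≤
        ∫ u in t₁..t₂, (c - h u - f u * ((k * (u - s)) ^ p') ^ (-(1 / p))) := by
      apply intervalIntegral.integral_mono_on h12 intervalIntegrable_const hint
      intro u hu
      have hu' : u ∈ Ioo s 1 := ⟨h1.trans_le hu.1, hu.2.trans_lt h2⟩
      have hus : 0 < u - s := by linarith [hu'.1]
      have hle : f u * ((k * (u - s)) ^ p') ^ (-(1 / p)) ≤ μ * k ^ (-(p' - 1)) := by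
        rw [← Real.rpow_mul (hY0 u hu'.1.le), mul_neg, hexp, Real.mul_rpow hk.le hus.le]
        have hcancel : (u - s) ^ (p' - 1) * (u - s) ^ (-(p' - 1)) = 1 := by
          rw [← Real.rpow_add hus]; simp
        calc f u * (k ^ (-(p' - 1)) * (u - s) ^ (-(p' - 1)))
            ≤ μ * (u - s) ^ (p' - 1) * (k ^ (-(p' - 1)) * (u - s) ^ (-(p' - 1))) := by
              gcongr; exact hfμ u hu'
          _ = μ * k ^ (-(p' - 1)) * ((u - s) ^ (p' - 1) * (u - s) ^ (-(p' - 1))) := by ring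
          _ = μ * k ^ (-(p' - 1)) := by rw [hcancel, mul_one]
      linarith [hhM u (Ioo_subset_Icc_self hu')]
    rw [intervalIntegral.integral_const, smul_eq_mul] at hmono
    linarith

/-- The admissible speeds form a closed half-line as soon as there is one. -/
lemma BoundedCoeffs.exists_threshold (H : BoundedCoeffs h f s M A)
    (hpp : p.HolderConjugate p') (hs : 0 ≤ s) (hfpos : ∀ t ∈ Ioo s 1, 0 < f t)
    (hlsc : LowerSemicontinuousOn f (Ioo s 1)) (hhc : ContinuousAt h s)
    (hne : ∃ c y, IsPosBVPSol p p' h f c s 1 y) :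
    ∃ cB, ∀ c, (∃ y, IsPosBVPSol p p' h f c s 1 y) ↔ cB ≤ c := by
  have hp' : 0 < 1 / p' := one_div_pos.2 hpp.symm.pos
  have h0 : (0 : ℝ) ^ (1 / p') = 0 := Real.zero_rpow hp'.ne'
  have hsmem : s ∈ Icc s 1 := left_mem_Icc.2 H.lt_one.le
  set S : Set ℝ := {c | ∃ y, IsPosBVPSol p p' h f c s 1 y} with hS
  have hbdd : BddBelow S := ⟨h s, fun c ⟨_, hy⟩ => hy.le_speed H hpp hhc⟩
  have key : ∀ c, ∃ y, IsCaraSol p p' h f c s 1 y ∧ (∀ t ∈ Ioo s 1, 0 < y t) ∧ y 1 = 0 := by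
    intro c
    obtain ⟨y, hy, hy1⟩ := H.exists_isCaraSol hpp hs c
    exact ⟨y, hy, hy.pos_of_terminal_zero H hpp hfpos hlsc hy1, hy1⟩
  have hup : ∀ c ∈ S, ∀ c', c ≤ c' → c' ∈ S := by
    rintro c ⟨Y, hY⟩ c' hcc'
    obtain ⟨y, hy, hpos, hy1⟩ := key c'
    have := hy.rpow_le H hpp hpos hy1 hY.1 hY.2.2.2 hY.2.2.1 le_rfl (by simpa) s hsmem
    rw [hY.2.1, h0] at this
    exact ⟨y, hy.isPosBVPSol H hpp hpos hy1 (by linarith)⟩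
  have hmem : sInf S ∈ S := by
    obtain ⟨y, hy, hpos, hy1⟩ := key (sInf S)
    refine ⟨y, hy.isPosBVPSol H hpp hpos hy1 (le_of_forall_pos_le_add fun ε hε => ?_)⟩
    obtain ⟨c, ⟨Y, hY⟩, hc⟩ := Real.lt_sInf_add_pos hne hε
    have := hy.rpow_le H hpp hpos hy1 hY.1 hY.2.2.2 hY.2.2.1 hε.le hc.le s hsmem
    rw [hY.2.1, h0] at this
    have : ε * (1 - s) ≤ ε := mul_le_of_le_one_right hε.le (by linarith)
    linarith
  exact ⟨sInf S, fun c => ⟨fun hc => csInf_le hbdd hc, fun hc => hup _ hmem c hc⟩⟩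

end

theorem stmt_11
    (p p' s : ℝ) (h f : ℝ → ℝ)
    (hp : 1 < p) (hp'def : p' = p / (p - 1))
    (hs : s ∈ Set.Ioo (0:ℝ) 1)
    (hmeas : Measurable h)
    (hbd : ∃ M : ℝ, ∀ t ∈ Set.Icc (0:ℝ) 1, |h t| ≤ M)
    (hfint : MeasureTheory.IntegrableOn f (Set.Ioo (0:ℝ) 1))
    (hf0 : f 0 = 0) (hfs : f s = 0) (hf1 : f 1 = 0)
    (hfneg : ∀ t ∈ Set.Ioo (0:ℝ) s, f t < 0)
    (hfpos : ∀ t ∈ Set.Ioo s (1:ℝ), 0 < f t)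
    (husc : UpperSemicontinuousOn f (Set.Ioo (0:ℝ) s))
    (hlsc : LowerSemicontinuousOn f (Set.Ioo s (1:ℝ)))
    (hhc : ContinuousAt h s)
    (hhfin : ∃ S : Finset ℝ, ContinuousOn h (Set.Icc (0:ℝ) 1 \ ↑S))
    (hbddB : BddAbove {x : ℝ | ∃ t ∈ Set.Ioo s (1:ℝ), x = f t / (t - s) ^ (p' - 1)})
    (hposB : 0 < sSup {x : ℝ | ∃ t ∈ Set.Ioo s (1:ℝ), x = f t / (t - s) ^ (p' - 1)}) :
    ((∫ t in s..(1:ℝ), h t) / (1 - s) < h s →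
      ∃ cB ∈ Set.Icc (h s)
          (sSup (h '' Set.Icc s (1:ℝ)) +
            p' ^ (1 / p') * p ^ (1 / p) *
              (sSup {x : ℝ | ∃ t ∈ Set.Ioo s (1:ℝ), x = f t / (t - s) ^ (p' - 1)}) ^ (1 / p')),
        (∀ c : ℝ, (∃ y, IsPosBVPSol p p' h f c s 1 y) ↔ cB ≤ c) ∧
        (∀ c : ℝ, ∀ y₁ y₂, IsPosBVPSol p p' h f c s 1 y₁ → IsPosBVPSol p p' h f c s 1 y₂ →
          Set.EqOn y₁ y₂ (Set.Icc s 1))) ∧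
    (h s ≤ (∫ t in s..(1:ℝ), h t) / (1 - s) →
      ∃ cB ∈ Set.Ioc ((∫ t in s..(1:ℝ), h t) / (1 - s))
          (sSup (h '' Set.Icc s (1:ℝ)) +
            p' ^ (1 / p') * p ^ (1 / p) *
              (sSup {x : ℝ | ∃ t ∈ Set.Ioo s (1:ℝ), x = f t / (t - s) ^ (p' - 1)}) ^ (1 / p')),
        (∀ c : ℝ, (∃ y, IsPosBVPSol p p' h f c s 1 y) ↔ cB ≤ c) ∧
        (∀ c : ℝ, ∀ y₁ y₂, IsPosBVPSol p p' h f c s 1 y₁ → IsPosBVPSol p p' h f c s 1 y₂ →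
          Set.EqOn y₁ y₂ (Set.Icc s 1))) := by
  obtain ⟨M, hM⟩ := hbd
  have hpp' : p.HolderConjugate p' := (Real.holderConjugate_iff_eq_conjExponent hp).2 hp'def
  have hs1 : 0 < 1 - s := sub_pos.2 hs.2
  have hIcc : Set.Icc s 1 ⊆ Set.Icc (0 : ℝ) 1 := Set.Icc_subset_Icc_left hs.1.le
  set μ := sSup {x : ℝ | ∃ t ∈ Set.Ioo s (1:ℝ), x = f t / (t - s) ^ (p' - 1)} with hμ
  have hfμ : ∀ t ∈ Set.Ioo s 1, f t ≤ μ * (t - s) ^ (p' - 1) := fun t ht => by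
    rw [← div_le_iff₀ (Real.rpow_pos_of_pos (sub_pos.2 ht.1) _)]
    exact le_csSup hbddB ⟨t, ht, rfl⟩
  have H : BoundedCoeffs h f s M μ := by
    refine ⟨hs.2, hmeas, fun t ht => hM t (hIcc ht), ?_, ?_, ?_⟩
    · rw [intervalIntegrable_iff_integrableOn_Ioo_of_le hs.2.le]
      exact hfint.mono_set (Set.Ioo_subset_Ioo_left hs.1.le)
    · intro t ht
      rcases ht.1.eq_or_lt with rfl | h1
      · exact hfs.ge
      rcases ht.2.eq_or_lt with rfl | h2
      · exact hf1.ge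
      exact (hfpos t ⟨h1, h2⟩).le
    · intro t ht
      rcases ht.1.eq_or_lt with rfl | h1
      · exact hfs.trans_le hposB.le
      rcases ht.2.eq_or_lt with rfl | h2
      · exact hf1.trans_le hposB.le
      refine (hfμ t ⟨h1, h2⟩).trans (mul_le_of_le_one_right hposB.le ?_)
      exact Real.rpow_le_one (by linarith) (by linarith [hs.1]) hpp'.symm.sub_one_pos.le
  have hhM : ∀ t ∈ Set.Icc s 1, h t ≤ sSup (h '' Set.Icc s 1) := fun t ht =>
    le_csSup ⟨M, by rintro _ ⟨u, hu, rfl⟩; exact (abs_le.1 (hM u (hIcc hu))).2⟩ ⟨t, ht, rfl⟩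
  obtain ⟨k, hk, hkeq⟩ := exists_slope_eq hpp' hposB
  have hex := H.exists_isPosBVPSol hpp' hs.1.le hfpos hlsc hhM hfμ hk le_rfl
  rw [hkeq] at hex
  obtain ⟨cB, hcB⟩ := H.exists_threshold hpp' hs.1.le hfpos hlsc hhc ⟨_, hex⟩
  obtain ⟨y, hy⟩ := (hcB cB).2 le_rfl
  have huniq : ∀ c : ℝ, ∀ y₁ y₂, IsPosBVPSol p p' h f c s 1 y₁ → IsPosBVPSol p p' h f c s 1 y₂ →
      Set.EqOn y₁ y₂ (Set.Icc s 1) := fun _ _ _ h1 h2 => h1.eqOn H hpp' h2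
  exact ⟨fun _ => ⟨cB, ⟨hy.le_speed H hpp' hhc, (hcB _).1 hex⟩, hcB, huniq⟩,
    fun _ => ⟨cB, ⟨hy.average_lt H hpp' hfpos, (hcB _).1 hex⟩, hcB, huniq⟩⟩
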